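/- arXiv:2601.15692 — 2 statements merged into one kernel-verified Lean document; each statement's English description precedes it below -/
import Mathlib

section
/- Let K be a field, L/K a field extension, and a, b, c pairwise coprime positive integers. Then the symbolic Rees algebra R_s(𝔭_K(a,b,c)) is Noetherian (equivalently, finitely generated over K[x,y,z]) if and only if R_s(𝔭_L(a,b,c)) is Noetherian. In particular, the finite generation of R_s(𝔭_K(a,b,c)) depends only on the characteristic of K and on a, b, c. -/
open MvPolynomial

noncomputable section

/-- The weight function assigning degrees `a, b, c` to the variables `x, y, z`. -/
def wt (a b c : ℕ) : Fin 3 → ℕ := ![a, b, c]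

/-- The `K`-algebra map `K[x,y,z] → K[T]`, `x ↦ T^a`, `y ↦ T^b`, `z ↦ T^c`. -/
def toPoly (K : Type*) [CommRing K] (a b c : ℕ) :
    MvPolynomial (Fin 3) K →ₐ[K] Polynomial K :=
  aeval ![Polynomial.X ^ a, Polynomial.X ^ b, Polynomial.X ^ c]

/-- The space monomial prime `𝔭_K(a,b,c)`. -/
def pIdeal (K : Type*) [CommRing K] (a b c : ℕ) : Ideal (MvPolynomial (Fin 3) K) :=
  RingHom.ker (toPoly K a b c)

instance pIdeal_isPrime (K : Type*) [Field K] (a b c : ℕ) : (pIdeal K a b c).IsPrime :=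
  RingHom.ker_isPrime _

/-- The `n`-th symbolic power `Q^{(n)} = Q^n A_Q ∩ A` of a prime ideal. -/
def symbPow {A : Type*} [CommRing A] (Q : Ideal A) [Q.IsPrime] (n : ℕ) : Ideal A :=
  Ideal.comap (algebraMap A (Localization.AtPrime Q))
    (Ideal.map (algebraMap A (Localization.AtPrime Q)) (Q ^ n))

/-- The symbolic Rees algebra `A[Qt, Q^{(2)}t^2, …] ⊆ A[t]`. -/
def symbolicRees {A : Type*} [CommRing A] (Q : Ideal A) [Q.IsPrime] :
    Subalgebra A (Polynomial A) :=
  Algebra.adjoin A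
    (⋃ n : ℕ, (fun p => Polynomial.C p * Polynomial.X ^ n) '' ((symbPow Q n : Ideal A) : Set A))

/-- The degree-`d` homogeneous component `[J]_d` of an ideal `J ⊆ K[x,y,z]`,
as a `K`-subspace. -/
def gpiece (K : Type*) [CommRing K] (a b c : ℕ) (J : Ideal (MvPolynomial (Fin 3) K))
    (d : ℕ) : Submodule K (MvPolynomial (Fin 3) K) :=
  (Submodule.restrictScalars K J) ⊓ (weightedHomogeneousSubmodule K (wt a b c) d)

end

section WeightedHomogeneous

variable {σ R : Type*} [CommRing R] (w : σ → ℕ)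

theorem weightedHomogeneousComponent_monomial (d : ℕ) (m : σ →₀ ℕ) (r : R) :
    weightedHomogeneousComponent w d (monomial m r) =
      if Finsupp.weight w m = d then monomial m r else 0 := by
  classical
  ext k
  rw [coeff_weightedHomogeneousComponent]
  split_ifs with h₁ h₂ h₂
  · rfl
  · rw [coeff_monomial, if_neg (by rintro rfl; exact h₂ h₁), coeff_zero]
  · rw [coeff_monomial, if_neg (by rintro rfl; exact h₁ h₂)]
  · rw [coeff_zero]

theorem weightedHomogeneousComponent_mul (d : ℕ) (f g : MvPolynomial σ R) :
    weightedHomogeneousComponent w d (f * g) =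
      ∑ x ∈ Finset.HasAntidiagonal.antidiagonal d,
        weightedHomogeneousComponent w x.1 f * weightedHomogeneousComponent w x.2 g := by
  induction f using MvPolynomial.induction_on' with
  | add p q hp hq => simp only [add_mul, map_add, hp, hq, Finset.sum_add_distrib]
  | monomial m r =>
    induction g using MvPolynomial.induction_on' with
    | add p q hp hq => simp only [mul_add, map_add, hp, hq, Finset.sum_add_distrib]
    | monomial k s =>
      simp only [monomial_mul, weightedHomogeneousComponent_monomial, map_add]
      by_cases h : Finsupp.weight w m + Finsupp.weight w k = d
      · rw [if_pos h, Finset.sum_eq_single (Finsupp.weight w m, Finsupp.weight w k)]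
        · simp [monomial_mul]
        · intro x _ hx
          split_ifs with h₁ h₂
          · exact absurd (Prod.ext h₁.symm h₂.symm) hx
          all_goals simp
        · intro hx
          exact absurd (Finset.HasAntidiagonal.mem_antidiagonal.2 h) hx
      · rw [if_neg h]
        refine (Finset.sum_eq_zero fun x hx => ?_).symm
        rw [Finset.HasAntidiagonal.mem_antidiagonal] at hx
        split_ifs with h₁ h₂
        · exact absurd (by rw [h₁, h₂, hx]) h
        all_goals simp

theorem weightedHomogeneousComponent_monomial_mul (d : ℕ) (m : σ →₀ ℕ) (f : MvPolynomial σ R) :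
    weightedHomogeneousComponent w (Finsupp.weight w m + d) (monomial m 1 * f) =
      monomial m 1 * weightedHomogeneousComponent w d f := by
  rw [weightedHomogeneousComponent_mul, Finset.sum_eq_single (Finsupp.weight w m, d)]
  · rw [weightedHomogeneousComponent_monomial, if_pos rfl]
  · intro x hx hne
    rw [weightedHomogeneousComponent_monomial, if_neg, zero_mul]
    intro h
    rw [Finset.HasAntidiagonal.mem_antidiagonal, ← h] at hx
    exact hne (Prod.ext h.symm (by simpa using hx))
  · simp

attribute [local instance] MvPolynomial.weightedGradedAlgebra

theorem isHomogeneous_iff_weightedHomogeneousComponent_mem {I : Ideal (MvPolynomial σ R)} :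
    I.IsHomogeneous (weightedHomogeneousSubmodule R w) ↔
      ∀ f ∈ I, ∀ d, weightedHomogeneousComponent w d f ∈ I := by
  refine ⟨fun h f hf d => weightedHomogeneousComponent_mem_of_mem R w h hf d, fun h d f hf => ?_⟩
  have := h f hf d
  rwa [← weightedDecomposition.decompose'_apply] at this

theorem Ideal.IsHomogeneous.weighted_pow {I : Ideal (MvPolynomial σ R)}
    (h : I.IsHomogeneous (weightedHomogeneousSubmodule R w)) (n : ℕ) :
    (I ^ n).IsHomogeneous (weightedHomogeneousSubmodule R w) := by
  induction n with
  | zero => rw [pow_zero, Ideal.one_eq_top]; exact Ideal.IsHomogeneous.top _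
  | succ n ih => rw [pow_succ]; exact ih.mul h

/-- The ideal of all `f` with `m * f ∈ I` for some monomial `m`. -/
def monomialSaturation (I : Ideal (MvPolynomial σ R)) : Ideal (MvPolynomial σ R) where
  carrier := {f | ∃ m : σ →₀ ℕ, monomial m 1 * f ∈ I}
  zero_mem' := ⟨0, by simp⟩
  add_mem' := by
    rintro f g ⟨m, hm⟩ ⟨k, hk⟩
    refine ⟨m + k, ?_⟩
    have h : (monomial (m + k) (1 : R)) = monomial m 1 * monomial k 1 := by simp [monomial_mul]
    rw [h, show monomial m (1 : R) * monomial k 1 * (f + g) =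
      monomial k 1 * (monomial m 1 * f) + monomial m 1 * (monomial k 1 * g) by ring]
    exact I.add_mem (I.mul_mem_left _ hm) (I.mul_mem_left _ hk)
  smul_mem' := by
    rintro r f ⟨m, hm⟩
    refine ⟨m, ?_⟩
    rw [smul_eq_mul, mul_left_comm]
    exact I.mul_mem_left _ hm

theorem mem_monomialSaturation {I : Ideal (MvPolynomial σ R)} {f : MvPolynomial σ R} :
    f ∈ monomialSaturation I ↔ ∃ m : σ →₀ ℕ, monomial m 1 * f ∈ I := Iff.rfl

theorem le_monomialSaturation (I : Ideal (MvPolynomial σ R)) : I ≤ monomialSaturation I :=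
  fun f hf => ⟨0, by simpa using hf⟩

theorem mem_monomialSaturation_of_monomial_mul_mem {I : Ideal (MvPolynomial σ R)} (m : σ →₀ ℕ)
    {f : MvPolynomial σ R} (h : monomial m 1 * f ∈ monomialSaturation I) :
    f ∈ monomialSaturation I := by
  obtain ⟨k, hk⟩ := h
  exact ⟨k + m, by simpa [← mul_assoc, monomial_mul] using hk⟩

theorem Ideal.IsHomogeneous.monomialSaturation {I : Ideal (MvPolynomial σ R)}
    (h : I.IsHomogeneous (weightedHomogeneousSubmodule R w)) :
    (monomialSaturation I).IsHomogeneous (weightedHomogeneousSubmodule R w) := by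
  rw [isHomogeneous_iff_weightedHomogeneousComponent_mem] at h ⊢
  rintro f ⟨m, hm⟩ d
  have hd := h _ hm (Finsupp.weight w m + d)
  rw [weightedHomogeneousComponent_monomial_mul] at hd
  exact ⟨m, hd⟩

end WeightedHomogeneous

theorem mem_of_pow_mul_mem {A : Type*} [CommRing A] {J : Ideal A} {s : A}
    (h : ∀ f, s * f ∈ J → f ∈ J) (n : ℕ) {f : A} (hf : s ^ n * f ∈ J) : f ∈ J := by
  induction n with
  | zero => simpa using hf
  | succ n ih => exact ih (h _ (by rwa [← mul_assoc, ← pow_succ']))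

/-- If `J` contains a power of `Q`, being a nonzerodivisor modulo `J` depends only on the class
modulo `Q`. -/
theorem mem_of_mul_mem_of_sub_mem {A : Type*} [CommRing A] {Q J : Ideal A} {n : ℕ}
    (hJ : Q ^ n ≤ J) {s t : A} (ht : ∀ f, t * f ∈ J → f ∈ J) (hst : s - t ∈ Q) {f : A}
    (hf : s * f ∈ J) : f ∈ J := by
  refine mem_of_pow_mul_mem ht n ?_
  obtain ⟨k, hk⟩ := sub_dvd_pow_sub_pow t (t - s) n
  rw [sub_sub_cancel] at hk
  have hq : (t - s) ^ n ∈ J := hJ (Ideal.pow_mem_pow (by simpa using Q.neg_mem hst) n)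
  rw [show t ^ n * f = k * (s * f) + f * (t - s) ^ n by linear_combination f * hk]
  exact J.add_mem (J.mul_mem_left _ hf) (J.mul_mem_left _ hq)

theorem mem_symbPow {A : Type*} [CommRing A] {Q : Ideal A} [Q.IsPrime] {n : ℕ} {f : A} :
    f ∈ symbPow Q n ↔ ∃ s ∉ Q, s * f ∈ Q ^ n := by
  rw [symbPow, Ideal.mem_comap,
    IsLocalization.algebraMap_mem_map_algebraMap_iff Q.primeCompl]
  rfl

section MonomialCurve

variable {F : Type*} [Field F] (a b c : ℕ)

theorem toPoly_monomial (m : Fin 3 →₀ ℕ) (r : F) :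
    toPoly F a b c (monomial m r) = Polynomial.monomial (Finsupp.weight (wt a b c) m) r := by
  rw [toPoly, aeval_monomial, ← Polynomial.C_mul_X_pow_eq_monomial, Finsupp.weight_apply,
    Finsupp.prod_fintype _ _ (by simp), Finsupp.sum_fintype _ _ (by simp)]
  simp [Fin.prod_univ_three, Fin.sum_univ_three, wt, ← pow_mul, ← pow_add, mul_comm a, mul_comm b,
    mul_comm c, Polynomial.C_eq_algebraMap]

theorem toPoly_weightedHomogeneousComponent (d : ℕ) (f : MvPolynomial (Fin 3) F) :
    toPoly F a b c (weightedHomogeneousComponent (wt a b c) d f) =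
      Polynomial.monomial d ((toPoly F a b c f).coeff d) := by
  induction f using MvPolynomial.induction_on' with
  | add p q hp hq => simp [hp, hq]
  | monomial m r =>
    rw [weightedHomogeneousComponent_monomial, toPoly_monomial, Polynomial.coeff_monomial]
    split_ifs with h
    · rw [toPoly_monomial, h]
    · simp

variable {a b c}

theorem mem_pIdeal {f : MvPolynomial (Fin 3) F} : f ∈ pIdeal F a b c ↔ toPoly F a b c f = 0 :=
  Iff.rfl

theorem monomial_notMem_pIdeal (m : Fin 3 →₀ ℕ) {r : F} (hr : r ≠ 0) :
    monomial m r ∉ pIdeal F a b c := by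
  rw [mem_pIdeal, toPoly_monomial, Polynomial.monomial_eq_zero_iff]
  exact hr

attribute [local instance] MvPolynomial.weightedGradedAlgebra

theorem pIdeal_isHomogeneous :
    (pIdeal F a b c).IsHomogeneous (weightedHomogeneousSubmodule F (wt a b c)) := by
  rw [isHomogeneous_iff_weightedHomogeneousComponent_mem]
  intro f hf d
  rw [mem_pIdeal] at hf ⊢
  rw [toPoly_weightedHomogeneousComponent, hf]
  simp

theorem exists_monomial_sub_mem_pIdeal {f : MvPolynomial (Fin 3) F} {d : ℕ}
    (h : weightedHomogeneousComponent (wt a b c) d f ∉ pIdeal F a b c) :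
    ∃ (m : Fin 3 →₀ ℕ) (r : F), r ≠ 0 ∧
      weightedHomogeneousComponent (wt a b c) d f - monomial m r ∈ pIdeal F a b c := by
  obtain ⟨m, hm⟩ := exists_coeff_ne_zero (fun h₀ => h (h₀ ▸ Ideal.zero_mem _) :
    weightedHomogeneousComponent (wt a b c) d f ≠ 0)
  have hwm := (weightedHomogeneousComponent_isWeightedHomogeneous (w := wt a b c) d f) hm
  rw [mem_pIdeal, toPoly_weightedHomogeneousComponent, Polynomial.monomial_eq_zero_iff] at h
  refine ⟨m, _, h, ?_⟩
  rw [mem_pIdeal, map_sub, toPoly_weightedHomogeneousComponent, toPoly_monomial, hwm, sub_self]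

variable {n : ℕ} {J : Ideal (MvPolynomial (Fin 3) F)}

theorem mem_of_component_mul_mem (hpJ : pIdeal F a b c ^ n ≤ J)
    (hsat : ∀ m f, monomial m 1 * f ∈ J → f ∈ J) {s : MvPolynomial (Fin 3) F} {d : ℕ}
    (hs : weightedHomogeneousComponent (wt a b c) d s ∉ pIdeal F a b c)
    {f : MvPolynomial (Fin 3) F}
    (hf : weightedHomogeneousComponent (wt a b c) d s * f ∈ J) : f ∈ J := by
  obtain ⟨m, r, hr, hmr⟩ := exists_monomial_sub_mem_pIdeal hs
  refine mem_of_mul_mem_of_sub_mem hpJ (fun g hg => hsat m g ?_) hmr hf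
  have h := J.mul_mem_left (C r⁻¹) hg
  rwa [← mul_assoc, C_mul_monomial, inv_mul_cancel₀ hr] at h

theorem mem_of_mul_mem_of_component_eq_zero (hpJ : pIdeal F a b c ^ n ≤ J)
    (hJ : J.IsHomogeneous (weightedHomogeneousSubmodule F (wt a b c)))
    (hsat : ∀ m f, monomial m 1 * f ∈ J → f ∈ J) {s : MvPolynomial (Fin 3) F} {d : ℕ}
    (hs : weightedHomogeneousComponent (wt a b c) d s ∉ pIdeal F a b c)
    (hlow : ∀ i < d, weightedHomogeneousComponent (wt a b c) i s = 0)
    {f : MvPolynomial (Fin 3) F} (hf : s * f ∈ J) : f ∈ J := by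
  rw [mem_iff_weightedHomogeneousComponent_mem F _ hJ]
  intro e
  induction e using Nat.strong_induction_on with
  | _ e ih =>
    refine mem_of_component_mul_mem hpJ hsat hs ?_
    have h := weightedHomogeneousComponent_mem_of_mem F _ hJ hf (d + e)
    rw [weightedHomogeneousComponent_mul,
      ← Finset.add_sum_erase _ _ (Finset.HasAntidiagonal.mem_antidiagonal.2 rfl : (d, e) ∈ _)] at h
    refine (Ideal.add_mem_iff_left J (J.sum_mem fun x hx => ?_)).1 h
    rw [Finset.mem_erase, Finset.HasAntidiagonal.mem_antidiagonal] at hx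
    rcases lt_trichotomy x.1 d with hlt | heq | hgt
    · rw [hlow _ hlt, zero_mul]
      exact J.zero_mem
    · exact absurd (Prod.ext heq (by have := hx.2; dsimp only; omega)) hx.1
    · exact J.mul_mem_left _ (ih _ (by omega))

theorem mem_of_mul_mem_of_notMem_pIdeal (hpJ : pIdeal F a b c ^ n ≤ J)
    (hJ : J.IsHomogeneous (weightedHomogeneousSubmodule F (wt a b c)))
    (hsat : ∀ m f, monomial m 1 * f ∈ J → f ∈ J) {s : MvPolynomial (Fin 3) F}
    (hs : s ∉ pIdeal F a b c) {f : MvPolynomial (Fin 3) F} (hf : s * f ∈ J) : f ∈ J := by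
  classical
  have hex : ∃ d, weightedHomogeneousComponent (wt a b c) d s ∉ pIdeal F a b c := by
    by_contra! h
    exact hs ((mem_iff_weightedHomogeneousComponent_mem F _ pIdeal_isHomogeneous s).2 h)
  have hd := Nat.find_spec hex
  have hlt : ∀ i < Nat.find hex,
      weightedHomogeneousComponent (wt a b c) i s ∈ pIdeal F a b c :=
    fun i hi => not_not.1 (Nat.find_min hex hi)
  set d := Nat.find hex
  set q := ∑ i ∈ Finset.range d, weightedHomogeneousComponent (wt a b c) i s with hq
  have hcomp : ∀ j, weightedHomogeneousComponent (wt a b c) j q =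
      if j < d then weightedHomogeneousComponent (wt a b c) j s else 0 := by
    intro j
    rw [hq, map_sum]
    simp_rw [weightedHomogeneousComponent_of_mem (weightedHomogeneousComponent_mem _ s _)]
    simp
  refine mem_of_mul_mem_of_sub_mem (t := s - q) hpJ (fun g hg =>
    mem_of_mul_mem_of_component_eq_zero (d := d) hpJ hJ hsat ?_ (fun i hi => ?_) hg) ?_ hf
  · simpa [hcomp] using hd
  · simp [hcomp, hi]
  · rw [sub_sub_cancel]
    exact Ideal.sum_mem _ fun i hi => hlt i (Finset.mem_range.1 hi)

theorem symbPow_pIdeal (n : ℕ) :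
    symbPow (pIdeal F a b c) n = monomialSaturation (pIdeal F a b c ^ n) := by
  ext f
  rw [mem_symbPow]
  constructor
  · rintro ⟨s, hs, hsf⟩
    exact mem_of_mul_mem_of_notMem_pIdeal (le_monomialSaturation _)
      (pIdeal_isHomogeneous.weighted_pow _ n).monomialSaturation
      (fun m _ => mem_monomialSaturation_of_monomial_mul_mem m) hs
      (le_monomialSaturation _ hsf)
  · rintro ⟨m, hm⟩
    exact ⟨_, monomial_notMem_pIdeal m one_ne_zero, hm⟩

end MonomialCurve

section SymbolicRees

variable {A : Type*} [CommRing A] {Q : Ideal A} [Q.IsPrime]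

theorem mul_mem_symbPow {m n : ℕ} {f g : A} (hf : f ∈ symbPow Q m) (hg : g ∈ symbPow Q n) :
    f * g ∈ symbPow Q (m + n) := by
  rw [mem_symbPow] at *
  obtain ⟨s, hs, hsf⟩ := hf
  obtain ⟨t, ht, htg⟩ := hg
  refine ⟨s * t, fun h => ((‹Q.IsPrime›.mem_or_mem h).elim hs ht), ?_⟩
  rw [mul_mul_mul_comm, pow_add]
  exact Ideal.mul_mem_mul hsf htg

theorem C_mul_X_pow_mem_symbolicRees {n : ℕ} {f : A} (hf : f ∈ symbPow Q n) :
    Polynomial.C f * Polynomial.X ^ n ∈ symbolicRees Q :=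
  Algebra.subset_adjoin (Set.mem_iUnion.2 ⟨n, f, hf, rfl⟩)

theorem mem_symbolicRees {P : Polynomial A} :
    P ∈ symbolicRees Q ↔ ∀ n, P.coeff n ∈ symbPow Q n := by
  refine ⟨fun h => ?_, fun h => ?_⟩
  · have h₀ : ∀ r : A, r ∈ symbPow Q 0 := fun r => by
      rw [mem_symbPow]
      exact ⟨1, fun h => ‹Q.IsPrime›.ne_top ((Ideal.eq_top_iff_one _).2 h), by simp⟩
    refine Algebra.adjoin_induction ?_ ?_ ?_ ?_ h
    · intro x hx n
      obtain ⟨k, p, hp, rfl⟩ := Set.mem_iUnion.1 hx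
      dsimp only
      rw [Polynomial.coeff_C_mul_X_pow]
      split_ifs with hn
      · exact hn ▸ hp
      · exact Ideal.zero_mem _
    · intro r n
      rw [Polynomial.algebraMap_eq, Polynomial.coeff_C]
      split_ifs with hn
      · exact hn ▸ h₀ r
      · exact Ideal.zero_mem _
    · intro x y _ _ hx hy n
      rw [Polynomial.coeff_add]
      exact Ideal.add_mem _ (hx n) (hy n)
    · intro x y _ _ hx hy n
      rw [Polynomial.coeff_mul]
      refine Ideal.sum_mem _ fun i hi => ?_
      rw [← Finset.HasAntidiagonal.mem_antidiagonal.1 hi]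
      exact mul_mem_symbPow (hx _) (hy _)
  · rw [P.as_sum_range_C_mul_X_pow]
    exact Subalgebra.sum_mem _ fun n _ => C_mul_X_pow_mem_symbolicRees (h n)

/-- A Noetherian symbolic Rees algebra is finitely generated. -/
theorem symbolicRees_fg (h : IsNoetherianRing (symbolicRees Q)) : (symbolicRees Q).FG := by
  classical
  set T : Set (symbolicRees Q) := {r | ∃ k, 0 < k ∧ ∃ q ∈ symbPow Q k,
    (r : Polynomial A) = Polynomial.C q * Polynomial.X ^ k} with hT
  obtain ⟨s, hsT, hs⟩ := (Submodule.fg_span_iff_fg_span_finset_subset T).1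
    ((isNoetherianRing_iff_ideal_fg _).1 h (Ideal.span T))
  refine ⟨s.image (↑), le_antisymm (Algebra.adjoin_le ?_) (Algebra.adjoin_le ?_)⟩
  · intro x hx
    obtain ⟨y, _, rfl⟩ := Finset.mem_image.1 hx
    exact y.2
  rintro x hx
  obtain ⟨n, p, hp, rfl⟩ := Set.mem_iUnion.1 hx
  dsimp only
  clear hx
  induction n using Nat.strong_induction_on generalizing p with
  | _ n ih =>
    rcases n.eq_zero_or_pos with rfl | hn
    · rw [pow_zero, mul_one]
      exact Subalgebra.algebraMap_mem _ p
    have hmem : (⟨_, C_mul_X_pow_mem_symbolicRees hp⟩ : symbolicRees Q) ∈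
        Submodule.span (symbolicRees Q) (s : Set (symbolicRees Q)) :=
      hs ▸ Submodule.subset_span ⟨n, hn, p, hp, rfl⟩
    obtain ⟨u, -, hu⟩ := Submodule.mem_span_finset.1 hmem
    have hu' : ∑ g ∈ s, (u g : Polynomial A) * (g : Polynomial A) =
        Polynomial.C p * Polynomial.X ^ n := by
      simpa using congrArg (Subtype.val) hu
    have hcoeff : p = ∑ g ∈ s, ((u g : Polynomial A) * (g : Polynomial A)).coeff n := by
      rw [← Polynomial.finsetSum_coeff, hu', Polynomial.coeff_C_mul_X_pow, if_pos rfl]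
    rw [hcoeff, map_sum, Finset.sum_mul]
    refine Subalgebra.sum_mem _ fun g hg => ?_
    have hgs : (g : Polynomial A) ∈ Algebra.adjoin A
        ((s.image (↑) : Finset (Polynomial A)) : Set (Polynomial A)) :=
      Algebra.subset_adjoin (Finset.mem_coe.2 (Finset.mem_image_of_mem _ hg))
    obtain ⟨k, hk, q, hq, hgq⟩ := hsT hg
    rw [hgq] at hgs ⊢
    rw [← mul_assoc, Polynomial.coeff_mul_X_pow']
    split_ifs with hkn
    · rw [Polynomial.coeff_mul_C, map_mul,
        show (Polynomial.X : Polynomial A) ^ n = Polynomial.X ^ (n - k) * Polynomial.X ^ k by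
          rw [← pow_add, Nat.sub_add_cancel hkn], mul_mul_mul_comm]
      exact Subalgebra.mul_mem _ (ih _ (by omega) _ (mem_symbolicRees.1 (u g).2 _)) hgs
    · simp

end SymbolicRees

section Coordinates

variable {K L : Type*} [Field K] [Field L] [Algebra K L] {σ : Type*}

/-- Apply a `K`-linear functional on `L` to the coefficients of a polynomial over `L`. -/
noncomputable def coordMap (φ : L →ₗ[K] K) : MvPolynomial σ L →+ MvPolynomial σ K where
  toFun f := AddMonoidAlgebra.map (φ : L →+ K) f
  map_zero' := AddMonoidAlgebra.map_zero _
  map_add' := AddMonoidAlgebra.map_add _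

theorem coeff_coordMap (φ : L →ₗ[K] K) (f : MvPolynomial σ L) (m : σ →₀ ℕ) :
    coeff m (coordMap φ f) = φ (coeff m f) := rfl

theorem coordMap_monomial (φ : L →ₗ[K] K) (m : σ →₀ ℕ) (r : L) :
    coordMap φ (monomial m r) = monomial m (φ r) := by
  classical
  ext k
  rw [coeff_coordMap, coeff_monomial, coeff_monomial]
  split_ifs <;> simp

theorem coordMap_map_mul (φ : L →ₗ[K] K) (g : MvPolynomial σ K) (f : MvPolynomial σ L) :
    coordMap φ (map (algebraMap K L) g * f) = g * coordMap φ f := by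
  classical
  ext m
  simp only [coeff_coordMap, coeff_mul, map_sum, coeff_map, ← Algebra.smul_def, map_smul,
    smul_eq_mul]

theorem coordMap_map (φ : L →ₗ[K] K) (hφ : φ 1 = 1) (g : MvPolynomial σ K) :
    coordMap φ (map (algebraMap K L) g) = g := by
  ext m
  rw [coeff_coordMap, coeff_map, Algebra.algebraMap_eq_smul_one, map_smul, hφ, smul_eq_mul,
    mul_one]

theorem mem_map_map_algebraMap {I : Ideal (MvPolynomial σ K)} {f : MvPolynomial σ L} :
    f ∈ I.map (map (algebraMap K L)) ↔ ∀ φ : L →ₗ[K] K, coordMap φ f ∈ I := by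
  classical
  refine ⟨fun h φ => ?_, fun h => ?_⟩
  · refine Submodule.span_induction (p := fun f _ => ∀ φ : L →ₗ[K] K, coordMap φ f ∈ I)
      ?_ ?_ ?_ ?_ h φ
    · rintro _ ⟨g, hg, rfl⟩ φ
      rw [← mul_one (map _ g), coordMap_map_mul]
      exact I.mul_mem_right _ hg
    · simp
    · intro x y _ _ hx hy φ
      rw [map_add]
      exact I.add_mem (hx φ) (hy φ)
    · intro a x _ hx φ
      induction a using MvPolynomial.induction_on' with
      | add p q hp hq =>
        rw [add_smul, map_add]
        exact I.add_mem hp hq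
      | monomial m r =>
        have : monomial m r • x = map (algebraMap K L) (monomial m 1) * (C r * x) := by
          rw [← mul_assoc, map_monomial, map_one, mul_comm (monomial m 1), C_mul_monomial, mul_one,
            smul_eq_mul]
        rw [this, coordMap_map_mul]
        refine I.mul_mem_left _ ?_
        have h' : coordMap φ (C r * x) = coordMap (φ ∘ₗ LinearMap.mulLeft K r) x := by
          ext k
          simp [coeff_coordMap, coeff_C_mul]
        rw [h']
        exact hx _
  · let b := Module.Basis.ofVectorSpace K L
    let s := f.support.biUnion fun m => (b.repr (coeff m f)).support
    have hf : f = ∑ i ∈ s, C (b i) * map (algebraMap K L) (coordMap (b.coord i) f) := by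
      ext m
      simp only [coeff_sum, coeff_C_mul, coeff_map, coeff_coordMap, b.coord_apply]
      conv_lhs => rw [← b.linearCombination_repr (coeff m f)]
      rw [Finsupp.linearCombination_apply_of_mem_supported K (s := s)]
      · exact Finset.sum_congr rfl fun i _ => by rw [Algebra.smul_def, mul_comm]
      · refine (Finsupp.mem_supported K _).2 ?_
        by_cases hm : m ∈ f.support
        · exact_mod_cast Finset.subset_biUnion_of_mem
            (fun m => (b.repr (coeff m f)).support) hm
        · simp [notMem_support_iff.1 hm]
    rw [hf]
    exact Ideal.sum_mem _ fun i _ => Ideal.mul_mem_left _ _ (Ideal.mem_map_of_mem _ (h _))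

/-- `coordMap`, applied to the coefficients of a univariate polynomial. -/
noncomputable def polyCoordMap (φ : L →ₗ[K] K) :
    Polynomial (MvPolynomial σ L) →+ Polynomial (MvPolynomial σ K) where
  toFun P := ⟨AddMonoidAlgebra.map (coordMap φ) P.toFinsupp⟩
  map_zero' := by simp
  map_add' P R := by simp [AddMonoidAlgebra.map_add]

theorem coeff_polyCoordMap (φ : L →ₗ[K] K) (P : Polynomial (MvPolynomial σ L)) (n : ℕ) :
    (polyCoordMap φ P).coeff n = coordMap φ (P.coeff n) := rfl

theorem polyCoordMap_map_mul (φ : L →ₗ[K] K) (P : Polynomial (MvPolynomial σ K))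
    (R : Polynomial (MvPolynomial σ L)) :
    polyCoordMap φ (P.map (map (algebraMap K L)) * R) = P * polyCoordMap φ R := by
  ext1 n
  simp only [coeff_polyCoordMap, Polynomial.coeff_mul, map_sum, Polynomial.coeff_map,
    coordMap_map_mul]

theorem polyCoordMap_map (φ : L →ₗ[K] K) (hφ : φ 1 = 1) (P : Polynomial (MvPolynomial σ K)) :
    polyCoordMap φ (P.map (map (algebraMap K L))) = P := by
  ext1 n
  rw [coeff_polyCoordMap, Polynomial.coeff_map, coordMap_map φ hφ]

end Coordinates

/-- Noetherianity descends along a ring homomorphism with a linear retraction. -/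
theorem isNoetherianRing_of_retraction {R S : Type*} [CommRing R] [CommRing S] (f : R →+* S)
    (g : S →+ R) (hgf : ∀ r s, g (f r * s) = r * g s) (hg : g 1 = 1) [IsNoetherianRing S] :
    IsNoetherianRing R := by
  have hcomap : Function.LeftInverse (Ideal.comap f) (Ideal.map f) := by
    refine fun I => le_antisymm (fun r hr => ?_) Ideal.le_comap_map
    have hmem : ∀ s ∈ I.map f, g s ∈ I := by
      intro s hs
      refine Submodule.span_induction (p := fun s _ => ∀ t, g (s * t) ∈ I) ?_ ?_ ?_ ?_ hs 1
        |> fun h => by simpa using h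
      · rintro _ ⟨r, hr, rfl⟩ t
        rw [hgf]
        exact I.mul_mem_right _ hr
      · simp
      · intro x y _ _ hx hy t
        rw [add_mul, map_add]
        exact I.add_mem (hx t) (hy t)
      · intro a x _ hx t
        rw [smul_eq_mul, mul_comm a, mul_assoc]
        exact hx _
    have h := hmem _ (Ideal.mem_comap.1 hr)
    rwa [← mul_one (f r), hgf, hg, mul_one] at h
  have hmono : StrictMono (Ideal.map f : Ideal R → Ideal S) :=
    Monotone.strictMono_of_injective (fun _ _ => Ideal.map_mono) hcomap.injective
  rw [isNoetherianRing_iff, isNoetherian_iff]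
  exact hmono.wellFoundedGT.wf

section BaseChange

variable {K L : Type*} [Field K] [Field L] [Algebra K L] {a b c : ℕ}

theorem toPoly_coordMap (φ : L →ₗ[K] K) (f : MvPolynomial (Fin 3) L) (d : ℕ) :
    (toPoly K a b c (coordMap φ f)).coeff d = φ ((toPoly L a b c f).coeff d) := by
  induction f using MvPolynomial.induction_on' with
  | add p q hp hq => simp [hp, hq]
  | monomial m r =>
    rw [coordMap_monomial, toPoly_monomial, toPoly_monomial, Polynomial.coeff_monomial,
      Polynomial.coeff_monomial]
    split_ifs <;> simp

theorem toPoly_map (f : MvPolynomial (Fin 3) K) :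
    toPoly L a b c (map (algebraMap K L) f) = (toPoly K a b c f).map (algebraMap K L) := by
  induction f using MvPolynomial.induction_on' with
  | add p q hp hq => simp [hp, hq]
  | monomial m r => simp [toPoly_monomial]

theorem map_pIdeal : (pIdeal K a b c).map (map (algebraMap K L)) = pIdeal L a b c := by
  refine le_antisymm (Ideal.map_le_iff_le_comap.2 fun f hf => ?_) fun f hf => ?_
  · rw [mem_pIdeal] at hf
    rw [Ideal.mem_comap, mem_pIdeal, toPoly_map, hf, Polynomial.map_zero]
  · refine mem_map_map_algebraMap.2 fun φ => ?_
    rw [mem_pIdeal] at hf ⊢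
    ext d
    rw [toPoly_coordMap, hf, Polynomial.coeff_zero, map_zero, Polynomial.coeff_zero]

/-- Symbolic powers of `𝔭` commute with extension of the ground field. -/
theorem map_symbPow_pIdeal (n : ℕ) :
    (symbPow (pIdeal K a b c) n).map (map (algebraMap K L)) = symbPow (pIdeal L a b c) n := by
  rw [symbPow_pIdeal, symbPow_pIdeal, ← map_pIdeal (K := K) (L := L), ← Ideal.map_pow]
  refine le_antisymm (Ideal.map_le_iff_le_comap.2 fun f hf => ?_) fun f hf => ?_
  · obtain ⟨m, hm⟩ := hf
    refine ⟨m, ?_⟩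
    have h := Ideal.mem_map_of_mem (map (algebraMap K L)) hm
    rwa [map_mul, map_monomial, map_one] at h
  · obtain ⟨m, hm⟩ := hf
    refine mem_map_map_algebraMap.2 fun φ => ⟨m, ?_⟩
    rw [← coordMap_map_mul, map_monomial, map_one]
    exact mem_map_map_algebraMap.1 hm φ

theorem map_mem_symbolicRees {P : Polynomial (MvPolynomial (Fin 3) K)}
    (hP : P ∈ symbolicRees (pIdeal K a b c)) :
    P.map (map (algebraMap K L)) ∈ symbolicRees (pIdeal L a b c) := by
  rw [mem_symbolicRees] at hP ⊢
  intro n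
  rw [Polynomial.coeff_map, ← map_symbPow_pIdeal (K := K)]
  exact Ideal.mem_map_of_mem _ (hP n)

theorem polyCoordMap_mem_symbolicRees (φ : L →ₗ[K] K) {P : Polynomial (MvPolynomial (Fin 3) L)}
    (hP : P ∈ symbolicRees (pIdeal L a b c)) :
    polyCoordMap φ P ∈ symbolicRees (pIdeal K a b c) := by
  rw [mem_symbolicRees] at hP ⊢
  intro n
  have h := hP n
  rw [← map_symbPow_pIdeal (K := K)] at h
  exact mem_map_map_algebraMap.1 h φ

theorem isNoetherianRing_symbolicRees_of_extension
    [IsNoetherianRing (symbolicRees (pIdeal L a b c))] :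
    IsNoetherianRing (symbolicRees (pIdeal K a b c)) := by
  obtain ⟨φ, hφ⟩ : ∃ φ : L →ₗ[K] K, φ 1 = 1 := by
    obtain ⟨φ, hφ⟩ := (Algebra.linearMap K L).exists_leftInverse_of_injective
      (LinearMap.ker_eq_bot.2 (algebraMap K L).injective)
    exact ⟨φ, by simpa using LinearMap.congr_fun hφ 1⟩
  let f : symbolicRees (pIdeal K a b c) →+* symbolicRees (pIdeal L a b c) :=
    (Polynomial.mapRingHom (map (algebraMap K L))).restrict _ _ fun _ => map_mem_symbolicRees
  let g : symbolicRees (pIdeal L a b c) →+ symbolicRees (pIdeal K a b c) :=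
    { toFun := fun P => ⟨polyCoordMap φ P, polyCoordMap_mem_symbolicRees φ P.2⟩
      map_zero' := Subtype.ext (map_zero _)
      map_add' := fun _ _ => Subtype.ext (map_add _ _ _) }
  refine isNoetherianRing_of_retraction f g
    (fun P R => Subtype.ext (polyCoordMap_map_mul φ P.1 R.1)) (Subtype.ext ?_)
  have h := polyCoordMap_map φ hφ (1 : Polynomial (MvPolynomial (Fin 3) K))
  rwa [Polynomial.map_one] at h

theorem isNoetherianRing_symbolicRees_extension
    (h : IsNoetherianRing (symbolicRees (pIdeal K a b c))) :
    IsNoetherianRing (symbolicRees (pIdeal L a b c)) := by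
  classical
  obtain ⟨s, hs⟩ := symbolicRees_fg h
  let ι := Polynomial.mapRingHom (map (algebraMap K L) : MvPolynomial (Fin 3) K →+* _)
  have hmap : ∀ P ∈ symbolicRees (pIdeal K a b c),
      ι P ∈ Algebra.adjoin (MvPolynomial (Fin 3) L) (s.image ι : Set _) := by
    intro P hP
    rw [← hs] at hP
    refine Algebra.adjoin_induction ?_ ?_ ?_ ?_ hP
    · intro x hx
      exact Algebra.subset_adjoin (Finset.mem_coe.2 (Finset.mem_image_of_mem _ hx))
    · intro r
      rw [Polynomial.algebraMap_eq, Polynomial.coe_mapRingHom, Polynomial.map_C]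
      exact Subalgebra.algebraMap_mem _ _
    · intro x y _ _ hx hy
      rw [map_add]
      exact Subalgebra.add_mem _ hx hy
    · intro x y _ _ hx hy
      rw [map_mul]
      exact Subalgebra.mul_mem _ hx hy
  have hfg : (symbolicRees (pIdeal L a b c)).FG := by
    refine ⟨s.image ι, le_antisymm (Algebra.adjoin_le fun x hx => ?_) (Algebra.adjoin_le ?_)⟩
    · obtain ⟨y, hy, rfl⟩ := Finset.mem_image.1 hx
      exact map_mem_symbolicRees (hs ▸ Algebra.subset_adjoin hy)
    · intro x hx
      obtain ⟨n, p, hp, rfl⟩ := Set.mem_iUnion.1 hx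
      rw [SetLike.mem_coe, ← map_symbPow_pIdeal (K := K)] at hp
      refine Submodule.span_induction (p := fun p _ => Polynomial.C p * Polynomial.X ^ n ∈ _)
        ?_ ?_ ?_ ?_ hp
      · rintro _ ⟨q, hq, rfl⟩
        simpa [ι] using hmap _ (C_mul_X_pow_mem_symbolicRees hq)
      · simp
      · intro x y _ _ hx hy
        rw [map_add, add_mul]
        exact Subalgebra.add_mem _ hx hy
      · intro r x _ hx
        rw [smul_eq_mul, map_mul, mul_assoc, ← Polynomial.smul_eq_C_mul]
        exact Subalgebra.smul_mem _ hx r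
  have := (Subalgebra.fg_iff_finiteType _).1 hfg
  exact Algebra.FiniteType.isNoetherianRing (MvPolynomial (Fin 3) L) _

end BaseChange

/-- for a field extension `L/K`, `R_s(𝔭_K(a,b,c))` is Noetherian
iff `R_s(𝔭_L(a,b,c))` is Noetherian. -/
theorem statement12 (K L : Type*) [Field K] [Field L] [Algebra K L] (a b c : ℕ)
    (ha : 0 < a) (hb : 0 < b) (hc : 0 < c)
    (hab : Nat.Coprime a b) (hbc : Nat.Coprime b c) (hca : Nat.Coprime c a) :
    IsNoetherianRing (symbolicRees (pIdeal K a b c)) ↔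
      IsNoetherianRing (symbolicRees (pIdeal L a b c)) := by
  exact ⟨isNoetherianRing_symbolicRees_extension, fun _ =>
    isNoetherianRing_symbolicRees_of_extension (L := L)⟩
end

section
/- Let 𝔽₂ be the field with two elements. Then [𝔭_{𝔽₂}(5,103,169)^{(59)}]_{17407} = 0. -/
open MvPolynomial

/-! ### Bit vectors and elimination over `𝔽₂` -/

/-- The `k`-th binary digit of `v`, as an element of `𝔽₂`. -/
def bit (v k : ℕ) : ZMod 2 := if v.testBit k then 1 else 0

theorem bit_xor (v w k : ℕ) : bit (v ^^^ w) k = bit v k + bit w k := by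
  unfold bit
  rw [Nat.testBit_xor]
  cases v.testBit k <;> cases w.testBit k <;> decide

/-- Gaussian elimination on bit vectors, with pivots at the positions of `mask` only. Returns the
vectors which are reduced to zero on `mask`. The first argument bounds the number of steps. -/
def elim (mask : ℕ) : ℕ → List ℕ → List ℕ
  | 0, L => L
  | _ + 1, [] => []
  | n + 1, v :: ws =>
    if v &&& mask = 0 then v :: elim mask n ws
    else elim mask n (ws.map fun w => bif w.testBit (Nat.log2 (v &&& mask)) then w ^^^ v else w)

/-- The linear combination of the bit vectors `L` with coefficients `cs`. -/
def dot : List (ZMod 2) → List ℕ → ℕ → ZMod 2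
  | x :: cs, v :: L, k => x * bit v k + dot cs L k
  | _, _, _ => 0

theorem dot_append {cs ds : List (ZMod 2)} {L M : List ℕ} (h : cs.length = L.length) (k : ℕ) :
    dot (cs ++ ds) (L ++ M) k = dot cs L k + dot ds M k := by
  induction cs generalizing L with
  | nil =>
    cases L with
    | nil => simp [dot]
    | cons => simp at h
  | cons x cs ih =>
    cases L with
    | nil => simp at h
    | cons v L =>
      simp only [List.cons_append, dot]
      rw [ih (by simpa using h), add_assoc]

/-- Adding a multiple of `v` to each of the vectors changes the combination by a multiple of `v`. -/
theorem exists_dot_map (v b : ℕ) (cs : List (ZMod 2)) (L : List ℕ) :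
    ∃ y : ZMod 2, ∀ k, dot cs L k =
      y * bit v k + dot cs (L.map fun w => bif w.testBit b then w ^^^ v else w) k := by
  induction cs generalizing L with
  | nil => exact ⟨0, fun k => by simp [dot]⟩
  | cons x cs ih =>
    cases L with
    | nil => exact ⟨0, fun k => by simp [dot]⟩
    | cons w L =>
      obtain ⟨y, hy⟩ := ih L
      cases hb : w.testBit b with
      | false => exact ⟨y, fun k => by simp only [dot, List.map_cons, hb, cond_false, hy]; ring⟩
      | true =>
        refine ⟨y - x, fun k => ?_⟩
        have hx : bit (w ^^^ v) k = bit w k + bit v k := bit_xor w v k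
        simp only [dot, List.map_cons, hb, cond_true, hy, hx]
        ring

theorem dot_map_pivot {v b : ℕ} (hv : v.testBit b = true) (cs : List (ZMod 2)) (L : List ℕ) :
    dot cs (L.map fun w => bif w.testBit b then w ^^^ v else w) b = 0 := by
  induction cs generalizing L with
  | nil => simp [dot]
  | cons x cs ih =>
    cases L with
    | nil => simp [dot]
    | cons w L =>
      simp only [dot, List.map_cons, ih]
      cases hb : w.testBit b with
      | false => simp [bit, hb]
      | true =>
        have hx : bit (w ^^^ v) b = bit w b + bit v b := bit_xor w v b
        rw [cond_true, hx]
        simp only [bit, hb, hv, if_true]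
        have h2 : (1 + 1 : ZMod 2) = 0 := by decide
        simp [h2]

theorem exists_dot_elim (mask n : ℕ) (cs : List (ZMod 2)) (L : List ℕ)
    (hl : cs.length = L.length) (h0 : ∀ k, mask.testBit k = true → dot cs L k = 0) :
    ∃ ds : List (ZMod 2), ds.length = (elim mask n L).length ∧
      (∀ k, dot cs L k = dot ds (elim mask n L) k) ∧ ((∀ x ∈ ds, x = 0) → ∀ x ∈ cs, x = 0) := by
  induction n generalizing cs L with
  | zero => exact ⟨cs, hl, fun _ => rfl, id⟩
  | succ n ih =>
    match cs, L, hl with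
    | [], [], _ => exact ⟨[], rfl, fun _ => rfl, id⟩
    | x :: cs, v :: ws, hl =>
      have hl' : cs.length = ws.length := by simpa using hl
      by_cases ht : v &&& mask = 0
      · have hv : ∀ k, mask.testBit k = true → bit v k = 0 := by
          intro k hk
          have := Nat.testBit_and v mask k
          rw [ht] at this
          simp only [Nat.zero_testBit, hk, Bool.and_true] at this
          simp [bit, ← this]
        have hE : elim mask (n + 1) (v :: ws) = v :: elim mask n ws := by
          simp [elim, ht]
        obtain ⟨ds, h1, h2, h3⟩ := ih cs ws hl' fun k hk => by
          simpa [dot, hv k hk] using h0 k hk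
        rw [hE]
        refine ⟨x :: ds, by simp [h1], fun k => by simp [dot, h2], ?_⟩
        intro h
        simp only [List.mem_cons, forall_eq_or_imp] at h ⊢
        exact ⟨h.1, h3 h.2⟩
      · have hE : elim mask (n + 1) (v :: ws) = elim mask n (ws.map fun w =>
            bif w.testBit (Nat.log2 (v &&& mask)) then w ^^^ v else w) := by
          simp only [elim, ht, if_false]
        have hbit : (v &&& mask).testBit (Nat.log2 (v &&& mask)) = true := Nat.testBit_log2 ht
        rw [hE]
        generalize Nat.log2 (v &&& mask) = b at hbit ⊢
        rw [Nat.testBit_and, Bool.and_eq_true] at hbit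
        obtain ⟨y, hy⟩ := exists_dot_map v b cs ws
        have hsum : ∀ k, dot (x :: cs) (v :: ws) k = (x + y) * bit v k +
            dot cs (ws.map fun w => bif w.testBit b then w ^^^ v else w) k := by
          intro k
          simp only [dot, hy]
          ring
        have hxy : x + y = 0 := by
          have := h0 b hbit.2
          rw [hsum, dot_map_pivot hbit.1] at this
          simpa [bit, hbit.1] using this
        have hsum' : ∀ k, dot (x :: cs) (v :: ws) k =
            dot cs (ws.map fun w => bif w.testBit b then w ^^^ v else w) k := by
          intro k
          rw [hsum, hxy, zero_mul, zero_add]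
        obtain ⟨ds, h1, h2, h3⟩ := ih cs (ws.map fun w => bif w.testBit b then w ^^^ v else w)
          (by simpa using hl') fun k hk => by rw [← hsum']; exact h0 k hk
        refine ⟨ds, h1, fun k => by rw [hsum', h2], fun h => ?_⟩
        have hcs := h3 h
        have hdot : ∀ (cs : List (ZMod 2)) (L : List ℕ) k, (∀ x ∈ cs, x = 0) →
            dot cs L k = 0 := by
          intro cs
          induction cs with
          | nil => intros; simp [dot]
          | cons z cs ih =>
            intro L k hz
            cases L with
            | nil => simp [dot]
            | cons w L =>
              simp only [List.mem_cons, forall_eq_or_imp] at hz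
              simp [dot, hz.1, ih L k hz.2]
        have hx : x = 0 := by
          have := hsum' b
          rw [dot_map_pivot hbit.1] at this
          simpa [dot, hdot cs ws b hcs, bit, hbit.1] using this
        simp only [List.mem_cons, forall_eq_or_imp]
        exact ⟨hx, hcs⟩

/-! ### Evaluation of the elimination with packed bit vectors -/

/-- Apply `k` to `n` after evaluating `n` to a numeral. -/
noncomputable def force {α : Type*} (n : ℕ) (k : ℕ → α) : α :=
  @Nat.rec (fun _ => α) (k 0) (fun m _ => k (Nat.succ m)) n

theorem force_eq {α : Type*} (n : ℕ) (k : ℕ → α) : force n k = k n := by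
  cases n <;> rfl

/-- The number whose digits in base `2 ^ W` are the elements of `L`. -/
def pack (W : ℕ) : List ℕ → ℕ
  | [] => 0
  | v :: L => 2 ^ W * pack W L + v

/-- The number with `n` digits in base `2 ^ W`, all of them equal to one. -/
def ones (W : ℕ) : ℕ → ℕ
  | 0 => 0
  | n + 1 => 2 ^ W * ones W n + 1

/-- The continuation `k` applied to the result of Gaussian elimination, where the `n` bit vectors of
length `W` are packed into the number `M`, so that a pivot is cleared in all of them at once. -/
noncomputable def elimPacked (mask W : ℕ) : ℕ → ℕ → (List ℕ → List ℕ) → List ℕ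
  | 0, _, k => k []
  | n + 1, M, k =>
    force (Nat.mod M (2 ^ W)) fun v => force (Nat.shiftRight M W) fun M' =>
      bif Nat.beq (Nat.land v mask) 0 then elimPacked mask W n M' fun L => k (v :: L)
      else force (Nat.xor M' (Nat.mul v
        (Nat.land (Nat.shiftRight M' (Nat.log2 (Nat.land v mask))) (ones W n)))) fun M'' =>
          elimPacked mask W n M'' k

theorem xor_two_pow_mul_add {W a c : ℕ} (ha : a < 2 ^ W) (hc : c < 2 ^ W) (A C : ℕ) :
    (2 ^ W * A + a) ^^^ (2 ^ W * C + c) = 2 ^ W * (A ^^^ C) + (a ^^^ c) := by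
  refine Nat.eq_of_testBit_eq fun k => ?_
  rw [Nat.testBit_xor, Nat.testBit_two_pow_mul_add _ ha, Nat.testBit_two_pow_mul_add _ hc,
    Nat.testBit_two_pow_mul_add _ (Nat.xor_lt_two_pow ha hc)]
  split_ifs <;> rw [Nat.testBit_xor]

theorem shiftRight_land_ones {W b w : ℕ} (hb : b < W) (hw : w < 2 ^ W) (P n : ℕ) :
    ((2 ^ W * P + w) >>> b) &&& ones W (n + 1) =
      2 ^ W * ((P >>> b) &&& ones W n) + (w.testBit b).toNat := by
  have h1 : 1 < 2 ^ W := Nat.one_lt_two_pow (by omega)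
  refine Nat.eq_of_testBit_eq fun k => ?_
  rw [Nat.testBit_and, Nat.testBit_shiftRight, Nat.testBit_two_pow_mul_add _ hw, ones,
    Nat.testBit_two_pow_mul_add _ h1,
    Nat.testBit_two_pow_mul_add _ ((Bool.toNat_le _).trans_lt h1), Nat.testBit_and,
    Nat.testBit_shiftRight]
  rcases Nat.lt_or_ge k W with hk | hk
  · rw [if_pos hk, if_pos hk]
    rcases k with _ | k
    · rw [add_zero, if_pos hb]
      cases w.testBit b <;> rfl
    · rw [Nat.testBit_succ, Nat.testBit_succ]
      cases w.testBit b <;> simp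
  · rw [if_neg (by omega), if_neg (by omega), if_neg (by omega),
      show b + k - W = b + (k - W) by omega]

theorem pack_clear {W b v : ℕ} (hb : b < W) (hv : v < 2 ^ W) {L : List ℕ}
    (hL : ∀ w ∈ L, w < 2 ^ W) :
    pack W L ^^^ (v * ((pack W L >>> b) &&& ones W L.length)) =
      pack W (L.map fun w => bif w.testBit b then w ^^^ v else w) := by
  induction L with
  | nil => simp [pack, ones]
  | cons w L ih =>
    simp only [List.mem_cons, forall_eq_or_imp] at hL
    rw [List.length_cons, pack, shiftRight_land_ones hb hL.1, mul_add, mul_left_comm, List.map_cons,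
      pack, xor_two_pow_mul_add hL.1, ih hL.2]
    · cases w.testBit b <;> simp
    · cases w.testBit b <;> simp [hv]

theorem elimPacked_eq (mask W : ℕ) {L : List ℕ} (hL : ∀ w ∈ L, w < 2 ^ W)
    (k : List ℕ → List ℕ) :
    elimPacked mask W L.length (pack W L) k = k (elim mask L.length L) := by
  induction hn : L.length generalizing L k with
  | zero =>
    rw [List.length_eq_zero_iff] at hn
    subst hn
    rfl
  | succ n ih =>
    cases L with
    | nil => simp at hn
    | cons v L =>
      simp only [List.mem_cons, forall_eq_or_imp] at hL
      rw [List.length_cons, Nat.add_right_cancel_iff] at hn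
      have h1 : Nat.mod (pack W (v :: L)) (2 ^ W) = v := by
        change (2 ^ W * pack W L + v) % 2 ^ W = v
        rw [Nat.mul_add_mod, Nat.mod_eq_of_lt hL.1]
      have h2 : Nat.shiftRight (pack W (v :: L)) W = pack W L := by
        change (2 ^ W * pack W L + v) >>> W = _
        rw [Nat.shiftRight_eq_div_pow, Nat.mul_add_div (by positivity), Nat.div_eq_of_lt hL.1,
          add_zero]
      rw [elimPacked, force_eq, force_eq, force_eq, h1, h2]
      by_cases ht : v &&& mask = 0
      · have hb : Nat.beq (Nat.land v mask) 0 = true := by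
          rw [show Nat.land v mask = 0 from ht]; rfl
        rw [hb, cond_true, ih hL.2 _ hn, elim, if_pos ht]
      · have hb : Nat.beq (Nat.land v mask) 0 = false := by
          rw [Bool.eq_false_iff]
          exact fun h => ht (Nat.eq_of_beq_eq_true h)
        have hlt : Nat.log2 (v &&& mask) < W :=
          (Nat.log2_lt ht).2 (Nat.and_le_left.trans_lt hL.1)
        have hM := pack_clear hlt hL.1 hL.2
        rw [hn] at hM
        have hM' := ih (L := L.map fun w =>
          bif w.testBit (Nat.log2 (v &&& mask)) then w ^^^ v else w) ?_ k (by simpa using hn)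
        · rw [← hM] at hM'
          rw [hb, cond_false, elim, if_neg ht]
          exact hM'
        · simp only [List.mem_map]
          rintro _ ⟨w, hw, rfl⟩
          cases w.testBit (Nat.log2 (v &&& mask)) with
          | false => exact hL.2 w hw
          | true => exact Nat.xor_lt_two_pow (hL.2 w hw) hL.1

theorem elim_lt {mask n N : ℕ} {L : List ℕ} (hL : ∀ w ∈ L, w < 2 ^ N) :
    ∀ w ∈ elim mask n L, w < 2 ^ N := by
  induction n generalizing L with
  | zero => exact hL
  | succ n ih =>
    cases L with
    | nil => simp [elim]
    | cons v L =>
      simp only [List.mem_cons, forall_eq_or_imp] at hL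
      rw [elim]
      split_ifs
      · simp only [List.mem_cons, forall_eq_or_imp]
        exact ⟨hL.1, ih hL.2⟩
      · refine ih fun _ hm => ?_
        obtain ⟨w, hw, rfl⟩ := List.mem_map.1 hm
        cases w.testBit (Nat.log2 (v &&& mask)) with
        | false => exact hL.2 w hw
        | true => exact Nat.xor_lt_two_pow (hL.2 w hw) hL.1

/-- The combination `∑ p ∈ S, c p * F p` of bit vectors is also a combination of the vectors in `L`,
which have length `W`, and `c` vanishes on `S` as soon as the coefficients of the latter do. -/
def ReducesTo {ι : Type*} (W : ℕ) (c : ι → ZMod 2) (F : ι → ℕ) (S : Finset ι) (L : List ℕ) : Prop :=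
  (∀ w ∈ L, w < 2 ^ W) ∧ ∃ cs : List (ZMod 2), cs.length = L.length ∧
    (∀ k, ∑ p ∈ S, c p * bit (F p) k = dot cs L k) ∧ ((∀ x ∈ cs, x = 0) → ∀ p ∈ S, c p = 0)

namespace ReducesTo

variable {ι : Type*} {W : ℕ} {c : ι → ZMod 2} {F : ι → ℕ}

theorem of_list [DecidableEq ι] {l : List ι} (hl : l.Nodup) (hF : ∀ p, F p < 2 ^ W) :
    ReducesTo W c F l.toFinset (l.map F) := by
  refine ⟨by simp [hF], l.map c, by simp, fun k => ?_, by simp⟩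
  rw [List.sum_toFinset _ hl]
  clear hl
  induction l with
  | nil => simp [dot]
  | cons a l ih => simp [dot, ih]

theorem union [DecidableEq ι] {S T : Finset ι} {L M : List ℕ} (hST : Disjoint S T)
    (hS : ReducesTo W c F S L) (hT : ReducesTo W c F T M) : ReducesTo W c F (S ∪ T) (L ++ M) := by
  obtain ⟨h0, cs, h1, h2, h3⟩ := hS
  obtain ⟨g0, ds, g1, g2, g3⟩ := hT
  refine ⟨fun w hw => (List.mem_append.1 hw).elim (h0 w) (g0 w), cs ++ ds, by simp [h1, g1],
    fun k => ?_, fun h p hp => ?_⟩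
  · rw [Finset.sum_union hST, h2, g2, dot_append h1]
  · simp only [List.mem_append, or_imp, forall_and] at h
    rcases Finset.mem_union.1 hp with hp | hp
    exacts [h3 h.1 p hp, g3 h.2 p hp]

theorem elimPacked {S : Finset ι} {L : List ℕ} {mask : ℕ} (hS : ReducesTo W c F S L)
    (h0 : ∀ k, mask.testBit k = true → ∑ p ∈ S, c p * bit (F p) k = 0) :
    ReducesTo W c F S (elimPacked mask W L.length (pack W L) id) := by
  obtain ⟨hL, cs, h1, h2, h3⟩ := hS
  rw [elimPacked_eq mask W hL, id]
  obtain ⟨ds, g1, g2, g3⟩ := exists_dot_elim mask L.length cs L h1 fun k hk => by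
    rw [← h2, h0 k hk]
  exact ⟨elim_lt hL, ds, g1, fun k => by rw [h2, g2], fun h => h3 (g3 h)⟩

theorem eq_zero {S : Finset ι} (hS : ReducesTo W c F S []) : ∀ p ∈ S, c p = 0 := by
  obtain ⟨-, cs, h1, -, h3⟩ := hS
  rw [List.length_nil, List.length_eq_zero_iff] at h1
  subst h1
  exact h3 (by simp)

end ReducesTo

/-- The elements of `S` at which `a` and `b` have the prescribed parities. -/
def parityClass {ι : Type*} (a b : ι → ℕ) (S : Finset ι) (e f : ℕ) : Finset ι :=
  S.filter fun p => a p % 2 = e ∧ b p % 2 = f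

theorem ReducesTo.of_parityClass {ι : Type*} [DecidableEq ι] {W : ℕ} {c : ι → ZMod 2} {F : ι → ℕ}
    {S : Finset ι} (a b : ι → ℕ) {L : ℕ → ℕ → List ℕ}
    (h : ∀ e < 2, ∀ f < 2, ReducesTo W c F (parityClass a b S e f) (L e f)) :
    ReducesTo W c F S ((L 0 0 ++ L 0 1) ++ (L 1 0 ++ L 1 1)) := by
  have hd : ∀ e f e' f', (e ≠ e' ∨ f ≠ f') →
      Disjoint (parityClass a b S e f) (parityClass a b S e' f') := by
    intro e f e' f' hne
    rw [Finset.disjoint_left]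
    simp only [parityClass, Finset.mem_filter]
    rintro p ⟨-, h1, h2⟩ ⟨-, h3, h4⟩
    omega
  have hS : S = (parityClass a b S 0 0 ∪ parityClass a b S 0 1) ∪
      (parityClass a b S 1 0 ∪ parityClass a b S 1 1) := by
    ext p
    simp only [parityClass, Finset.mem_union, Finset.mem_filter]
    have := Nat.mod_two_eq_zero_or_one (a p)
    have := Nat.mod_two_eq_zero_or_one (b p)
    tauto
  rw [hS]
  refine .union ?_ (.union (hd _ _ _ _ (by simp)) ?_ ?_) (.union (hd _ _ _ _ (by simp)) ?_ ?_)
  · simp only [Finset.disjoint_union_left, Finset.disjoint_union_right]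
    refine ⟨⟨?_, ?_⟩, ?_, ?_⟩ <;> exact hd _ _ _ _ (by simp)
  all_goals exact h _ (by norm_num) _ (by norm_num)

/-! ### Binomial coefficients modulo two -/

theorem choose_two_mul (a i : ℕ) : (a.choose (2 * i) : ZMod 2) = (a / 2).choose i := by
  have h := Choose.choose_modEq_choose_mod_mul_choose_div_nat (n := a) (k := 2 * i) (p := 2)
  rw [← ZMod.natCast_eq_natCast_iff] at h
  simpa using h

theorem choose_two_mul_add_one (a i : ℕ) :
    (a.choose (2 * i + 1) : ZMod 2) = (a % 2 : ℕ) * (a / 2).choose i := by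
  have h := Choose.choose_modEq_choose_mod_mul_choose_div_nat (n := a) (k := 2 * i + 1) (p := 2)
  rw [← ZMod.natCast_eq_natCast_iff] at h
  rw [h, show (2 * i + 1) % 2 = 1 by omega, show (2 * i + 1) / 2 = i by omega]
  simp

theorem parity_mul_choose (a e i : ℕ) (he : e < 2) :
    (if a % 2 = e then ((a / 2).choose i : ZMod 2) else 0) =
      (1 - e : ℕ) * a.choose (2 * i) + a.choose (2 * i + 1) := by
  rw [choose_two_mul, choose_two_mul_add_one]
  have h2 : ∀ z : ZMod 2, z + z = 0 := CharTwo.add_self_eq_zero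
  rcases Nat.mod_two_eq_zero_or_one a with h | h <;> interval_cases e <;> simp [h, h2]

theorem sum_choose_half {ι : Type*} {c : ι → ZMod 2} {a b : ι → ℕ} {S : Finset ι} {n : ℕ}
    (h : ∀ i j, i + j ≤ 2 * n → ∑ p ∈ S, c p * ((a p).choose i * (b p).choose j) = 0)
    {i j : ℕ} (hij : i + j ≤ n) :
    ∑ p ∈ S, c p * ((a p / 2).choose i * (b p / 2).choose j) = 0 := by
  simpa only [choose_two_mul] using h (2 * i) (2 * j) (by omega)

theorem sum_choose_half_parityClass {ι : Type*} {c : ι → ZMod 2} {a b : ι → ℕ} {S : Finset ι}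
    {n : ℕ} (h : ∀ i j, i + j ≤ 2 * n → ∑ p ∈ S, c p * ((a p).choose i * (b p).choose j) = 0)
    {e f i j : ℕ} (he : e < 2) (hf : f < 2) (hij : i + j < n) :
    ∑ p ∈ parityClass a b S e f, c p * ((a p / 2).choose i * (b p / 2).choose j) = 0 := by
  rw [parityClass, Finset.sum_filter]
  have key : ∀ p, (if a p % 2 = e ∧ b p % 2 = f then
      c p * (((a p / 2).choose i : ZMod 2) * (b p / 2).choose j) else 0) =
      (1 - e : ℕ) * (1 - f : ℕ) * (c p * ((a p).choose (2 * i) * (b p).choose (2 * j))) +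
      (1 - e : ℕ) * (c p * ((a p).choose (2 * i) * (b p).choose (2 * j + 1))) +
      (1 - f : ℕ) * (c p * ((a p).choose (2 * i + 1) * (b p).choose (2 * j))) +
      (c p * ((a p).choose (2 * i + 1) * (b p).choose (2 * j + 1))) := by
    intro p
    have h1 := parity_mul_choose (a p) e i he
    have h2 := parity_mul_choose (b p) f j hf
    calc _ = c p * ((if a p % 2 = e then ((a p / 2).choose i : ZMod 2) else 0) *
          (if b p % 2 = f then ((b p / 2).choose j : ZMod 2) else 0)) := by
          clear h h1 h2; split_ifs <;> simp_all
      _ = _ := by rw [h1, h2]; ring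
  simp only [key, Finset.sum_add_distrib, ← Finset.mul_sum]
  rw [h _ _ (by omega), h _ _ (by omega), h _ _ (by omega), h _ _ (by omega)]
  simp

/-- The bit vector obtained from `v` by multiplying it `a` times by `1 + 2 ^ D`, without carries. -/
noncomputable def pascal (D v a : ℕ) : ℕ :=
  @Nat.rec (fun _ => ℕ) v (fun _ r => force r fun r => Nat.xor r (Nat.shiftLeft r D)) a

theorem pascal_zero (D v : ℕ) : pascal D v 0 = v := rfl

theorem pascal_succ (D v a : ℕ) : pascal D v (a + 1) = pascal D v a ^^^ (pascal D v a <<< D) :=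
  force_eq (pascal D v a) fun r => Nat.xor r (Nat.shiftLeft r D)

theorem bit_pascal {D v : ℕ} (hv : v < 2 ^ D) (a i : ℕ) {j : ℕ} (hj : j < D) :
    bit (pascal D v a) (D * i + j) = a.choose i * bit v j := by
  induction a generalizing i with
  | zero =>
    cases i with
    | zero => simp [pascal_zero]
    | succ i =>
      have : v.testBit (D * (i + 1) + j) = false :=
        Nat.testBit_lt_two_pow (hv.trans_le (Nat.pow_le_pow_right (by norm_num) (by
          rw [Nat.mul_succ]; omega)))
      simp [pascal_zero, bit, this]
  | succ a ih =>
    rw [pascal_succ, bit_xor, ih]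
    cases i with
    | zero =>
      have : bit (pascal D v a <<< D) (D * 0 + j) = 0 := by
        simp [bit, Nat.testBit_shiftLeft, hj]
      rw [this]; simp
    | succ i =>
      have : bit (pascal D v a <<< D) (D * (i + 1) + j) = bit (pascal D v a) (D * i + j) := by
        have h1 : D * (i + 1) + j = D * i + j + D := by ring
        simp [bit, Nat.testBit_shiftLeft, h1]
      rw [this, ih, Nat.choose_succ_succ]
      push_cast; ring

theorem bit_mod_two_pow {v n k : ℕ} (hk : k < n) : bit (v % 2 ^ n) k = bit v k := by
  simp [bit, Nat.testBit_mod_two_pow, hk]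

theorem bit_mod_two_pow_of_le {v n k : ℕ} (hk : n ≤ k) : bit (v % 2 ^ n) k = 0 := by
  simp [bit, Nat.testBit_mod_two_pow, hk.not_gt]

theorem bit_shiftLeft_of_lt {v n k : ℕ} (hk : k < n) : bit (v <<< n) k = 0 := by
  simp [bit, Nat.testBit_shiftLeft, hk.not_ge]

theorem bit_shiftLeft_add (v n k : ℕ) : bit (v <<< n) (n + k) = bit v k := by
  simp [bit, Nat.testBit_shiftLeft]

/-- Up to position `D * D`, the bits of `binomialBits D a b` are the products of the binomial
coefficients of `a` and `b`. -/
noncomputable def binomialBits (D a b : ℕ) : ℕ :=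
  force a fun a => force (Nat.mod (pascal 1 1 b) (2 ^ D)) fun r => pascal D r a

theorem bit_binomialBits (D a b i : ℕ) {j : ℕ} (hj : j < D) :
    bit (binomialBits D a b) (D * i + j) = a.choose i * b.choose j := by
  rw [binomialBits, force_eq, force_eq]
  have h := bit_pascal (D := 1) (v := 1) (by norm_num) b j (j := 0) (by norm_num)
  rw [one_mul, add_zero] at h
  change bit (pascal D (pascal 1 1 b % 2 ^ D) a) _ = _
  rw [bit_pascal (Nat.mod_lt _ (by positivity)) a i hj, bit_mod_two_pow hj, h]
  simp [bit]

/-- The number whose binary digits equal to one are at the positions in `l`. -/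
def maskOf (l : List ℕ) : ℕ := l.foldr (fun k m => Nat.lor m (Nat.shiftLeft 1 k)) 0

theorem mem_of_testBit_maskOf {l : List ℕ} {k : ℕ} (h : (maskOf l).testBit k = true) : k ∈ l := by
  induction l with
  | nil => simp [maskOf] at h
  | cons a l ih =>
    have h1 : maskOf (a :: l) = maskOf l ||| (1 <<< a) := rfl
    rw [h1, Nat.testBit_or, Bool.or_eq_true] at h
    rcases h with h | h
    · exact List.mem_cons_of_mem _ (ih h)
    · rw [Nat.one_shiftLeft, Nat.testBit_two_pow, decide_eq_true_eq] at h
      simp [h]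

/-! ### The monomials of degree `17407` -/

/-- Exponents `(j, k)` of `y` and `z` in the monomials of degree `17407`. -/
def isExponent (p : ℕ × ℕ) : Bool :=
  Nat.ble (103 * p.1 + 169 * p.2) 17407 && Nat.beq ((17407 - (103 * p.1 + 169 * p.2)) % 5) 0

theorem isExponent_iff {p : ℕ × ℕ} : isExponent p = true ↔
    103 * p.1 + 169 * p.2 ≤ 17407 ∧ (17407 - (103 * p.1 + 169 * p.2)) % 5 = 0 := by
  simp [isExponent]

/-- The set of exponents `(j, k)` of `y` and `z` in the monomials of degree `17407`. -/
def exponents : Finset (ℕ × ℕ) :=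
  (Finset.range 170 ×ˢ Finset.range 104).filter fun p => isExponent p = true

theorem mem_exponents {p : ℕ × ℕ} : p ∈ exponents ↔ isExponent p = true := by
  simp only [exponents, Finset.mem_filter, Finset.mem_product, Finset.mem_range, isExponent_iff]
  omega

attribute [irreducible] exponents

/-- The numbers below `n` satisfying `P`. -/
noncomputable def filterBelow (P : ℕ → Bool) (n : ℕ) : List ℕ :=
  @Nat.rec (fun _ => List ℕ) [] (fun m L => bif P m then m :: L else L) n

theorem filterBelow_succ (P : ℕ → Bool) (n : ℕ) :
    filterBelow P (n + 1) = bif P n then n :: filterBelow P n else filterBelow P n := rfl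

theorem mem_filterBelow {P : ℕ → Bool} {n m : ℕ} :
    m ∈ filterBelow P n ↔ m < n ∧ P m = true := by
  induction n with
  | zero => simp [filterBelow]
  | succ n ih =>
    rw [filterBelow_succ]
    cases h : P n
    · rw [cond_false, ih]
      have : P m = true → m ≠ n := by rintro h1 rfl; simp [h] at h1
      exact ⟨fun h => ⟨by omega, h.2⟩, fun h => ⟨by have := this h.2; omega, h.2⟩⟩
    · rw [cond_true, List.mem_cons, ih]
      constructor
      · rintro (rfl | h1)
        exacts [⟨by omega, h⟩, ⟨by omega, h1.2⟩]
      · rintro ⟨h1, h2⟩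
        rcases eq_or_ne m n with h3 | h3
        exacts [.inl h3, .inr ⟨by omega, h2⟩]

theorem filterBelow_nodup (P : ℕ → Bool) (n : ℕ) : (filterBelow P n).Nodup := by
  induction n with
  | zero => simp [filterBelow]
  | succ n ih =>
    rw [filterBelow_succ]
    cases P n
    · exact ih
    · exact List.nodup_cons.2 ⟨fun h => absurd (mem_filterBelow.1 h).1 (lt_irrefl n), ih⟩

/-- The `m`-th point of a residue class modulo four. -/
def classPoint (e f u v m : ℕ) : ℕ × ℕ :=
  (4 * (m % 43) + (2 * u + e), 4 * (m / 43) + (2 * v + f))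

/-- The exponents in a given residue class modulo four. -/
noncomputable def exponentList (e f e' f' : ℕ) : List (ℕ × ℕ) :=
  (filterBelow (fun m => isExponent (classPoint e f e' f' m)) 1118).map (classPoint e f e' f')

theorem exponentList_nodup (e f e' f' : ℕ) : (exponentList e f e' f').Nodup := by
  refine List.Nodup.map (fun m n h => ?_) (filterBelow_nodup _ _)
  simp only [classPoint, Prod.mk.injEq] at h
  omega

theorem exponentList_toFinset {e f e' f' : ℕ} (he : e < 2) (hf : f < 2) (he' : e' < 2)
    (hf' : f' < 2) : (exponentList e f e' f').toFinset =
      parityClass (fun p => p.1 / 2) (fun p => p.2 / 2)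
        (parityClass Prod.fst Prod.snd exponents e f) e' f' := by
  ext ⟨x, y⟩
  simp only [exponentList, List.mem_toFinset, List.mem_map, parityClass, Finset.mem_filter,
    mem_exponents, mem_filterBelow]
  constructor
  · rintro ⟨m, ⟨-, hP⟩, h⟩
    rw [h] at hP
    simp only [classPoint, Prod.mk.injEq] at h
    refine ⟨⟨hP, ?_, ?_⟩, ?_, ?_⟩ <;> omega
  · rintro ⟨⟨hP, h1, h2⟩, h3, h4⟩
    have hlt := isExponent_iff.1 hP
    simp only at hlt
    have hm : classPoint e f e' f' (43 * (y / 4) + x / 4) = (x, y) := by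
      simp only [classPoint, Prod.mk.injEq]
      omega
    exact ⟨_, ⟨by omega, by rw [hm]; exact hP⟩, hm⟩

/-- The values at `p` of the functionals used in the elimination: products of binomial coefficients
of `p / 4` (below position `256`) and of `p / 2` (from position `256` on). -/
noncomputable def exponentVec (p : ℕ × ℕ) : ℕ :=
  Nat.mod (Nat.xor (Nat.mod (binomialBits 16 (p.1 / 2 / 2) (p.2 / 2 / 2)) (2 ^ 256))
    (Nat.shiftLeft (binomialBits 32 (p.1 / 2) (p.2 / 2)) 256)) (2 ^ 1216)

theorem exponentVec_eq (p : ℕ × ℕ) : exponentVec p =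
    ((binomialBits 16 (p.1 / 2 / 2) (p.2 / 2 / 2) % 2 ^ 256) ^^^
      (binomialBits 32 (p.1 / 2) (p.2 / 2) <<< 256)) % 2 ^ 1216 := rfl

set_option exponentiation.threshold 2048 in
theorem exponentVec_lt (p : ℕ × ℕ) : exponentVec p < 2 ^ 1216 :=
  (exponentVec_eq p).trans_lt (Nat.mod_lt _ (Nat.two_pow_pos _))

theorem bit_exponentVec_quarter (p : ℕ × ℕ) {i j : ℕ} (hi : i ≤ 14) (hj : j ≤ 14) :
    bit (exponentVec p) (16 * i + j) = (p.1 / 2 / 2).choose i * (p.2 / 2 / 2).choose j := by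
  rw [exponentVec_eq, bit_mod_two_pow (by omega), bit_xor, bit_mod_two_pow (by omega),
    bit_shiftLeft_of_lt (by omega), bit_binomialBits 16 _ _ _ (by omega), add_zero]

theorem bit_exponentVec_half (p : ℕ × ℕ) {i j : ℕ} (hi : i ≤ 29) (hj : j ≤ 29) :
    bit (exponentVec p) (256 + (32 * i + j)) = (p.1 / 2).choose i * (p.2 / 2).choose j := by
  rw [exponentVec_eq, bit_mod_two_pow (by omega), bit_xor, bit_mod_two_pow_of_le (by omega),
    bit_shiftLeft_add, bit_binomialBits 32 _ _ _ (by omega), zero_add]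

/-- Positions of the functionals of total order below `14` at `p / 4`. -/
def lowerPositions : List ℕ :=
  (List.range 14).flatMap fun i => (List.range (14 - i)).map fun j => 16 * i + j

/-- Positions of the functionals of total order `14` at `p / 4`. -/
def middlePositions : List ℕ := (List.range 15).map fun i => 16 * i + (14 - i)

/-- Positions of the functionals of total order `29` at `p / 2`. -/
def upperPositions : List ℕ := (List.range 30).map fun i => 256 + (32 * i + (29 - i))

/-- Gaussian elimination on the vectors `L` of length `1216`, with pivots at `positions`. -/
noncomputable def clear (positions L : List ℕ) : List ℕ :=
  elimPacked (maskOf positions) 1216 L.length (pack 1216 L) id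

theorem ReducesTo.clear {c : ℕ × ℕ → ZMod 2} {F : ℕ × ℕ → ℕ} {S : Finset (ℕ × ℕ)}
    {positions L : List ℕ} (hS : ReducesTo 1216 c F S L)
    (h0 : ∀ k ∈ positions, ∑ p ∈ S, c p * bit (F p) k = 0) :
    ReducesTo 1216 c F S (clear positions L) :=
  hS.elimPacked fun k hk => h0 k (mem_of_testBit_maskOf hk)

/-- What is left of a class of exponents modulo four after elimination. -/
noncomputable def quarterRemainder (e f e' f' : ℕ) : List ℕ :=
  clear lowerPositions ((exponentList e f e' f').map exponentVec)

/-- What is left of a class of exponents modulo two after elimination. -/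
noncomputable def halfRemainder (e f : ℕ) : List ℕ :=
  clear middlePositions ((quarterRemainder e f 0 0 ++ quarterRemainder e f 0 1) ++
    (quarterRemainder e f 1 0 ++ quarterRemainder e f 1 1))

/-- What is left of all exponents after elimination. -/
noncomputable def remainder : List ℕ :=
  clear upperPositions ((halfRemainder 0 0 ++ halfRemainder 0 1) ++
    (halfRemainder 1 0 ++ halfRemainder 1 1))

theorem remainder_eq_nil : remainder = [] :=
  List.isEmpty_iff.1 (by decide +kernel)

theorem eq_zero_of_sum_choose_eq_zero (c : ℕ × ℕ → ZMod 2)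
    (h : ∀ i j, i + j ≤ 58 → ∑ p ∈ exponents, c p * (p.1.choose i * p.2.choose j) = 0) :
    ∀ p ∈ exponents, c p = 0 := by
  have hhalf : ∀ e < 2, ∀ f < 2, ∀ i j, i + j ≤ 2 * 14 →
      ∑ p ∈ parityClass Prod.fst Prod.snd exponents e f,
        c p * ((p.1 / 2).choose i * (p.2 / 2).choose j) = 0 := fun e he f hf i j hij =>
    sum_choose_half_parityClass (n := 29) h he hf (by omega)
  have hred : ReducesTo 1216 c exponentVec exponents remainder := by
    refine .clear (.of_parityClass Prod.fst Prod.snd (L := halfRemainder) ?_) ?_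
    · intro e he f hf
      refine .clear (.of_parityClass (fun p => p.1 / 2) (fun p => p.2 / 2)
        (L := quarterRemainder e f) ?_) ?_
      · intro e' he' f' hf'
        rw [← exponentList_toFinset he hf he' hf']
        refine .clear (.of_list (exponentList_nodup e f e' f') exponentVec_lt) ?_
        intro k hk
        simp only [lowerPositions, List.mem_flatMap, List.mem_map, List.mem_range] at hk
        obtain ⟨i, hi, j, hj, rfl⟩ := hk
        rw [exponentList_toFinset he hf he' hf',
          ← sum_choose_half_parityClass (n := 14) (hhalf e he f hf) he' hf' (i := i) (j := j)
            (by omega)]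
        refine Finset.sum_congr rfl fun p _ => ?_
        rw [bit_exponentVec_quarter p (by omega) (by omega)]
      · intro k hk
        simp only [middlePositions, List.mem_map, List.mem_range] at hk
        obtain ⟨i, hi, rfl⟩ := hk
        rw [← sum_choose_half (n := 14) (hhalf e he f hf) (i := i) (j := 14 - i) (by omega)]
        refine Finset.sum_congr rfl fun p _ => ?_
        rw [bit_exponentVec_quarter p (by omega) (by omega)]
    · intro k hk
      simp only [upperPositions, List.mem_map, List.mem_range] at hk
      obtain ⟨i, hi, rfl⟩ := hk
      rw [← sum_choose_half (n := 29) h (i := i) (j := 29 - i) (by omega)]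
      refine Finset.sum_congr rfl fun p _ => ?_
      rw [bit_exponentVec_half p (by omega) (by omega)]
  rw [remainder_eq_nil] at hred
  exact hred.eq_zero

/-! ### Symbolic powers and vanishing of differential operators -/

theorem mem_symbPow_iff {A : Type*} [CommRing A] [IsDomain A] {Q : Ideal A} [Q.IsPrime] {n : ℕ}
    {f : A} : f ∈ symbPow Q n ↔ ∃ g ∉ Q, f * g ∈ Q ^ n := by
  rw [symbPow, Ideal.mem_comap, IsLocalization.mem_map_algebraMap_iff Q.primeCompl]
  constructor
  · rintro ⟨⟨x, g⟩, h⟩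
    rw [← map_mul] at h
    have hinj := IsLocalization.injective (Localization.AtPrime Q) Q.primeCompl_le_nonZeroDivisors
    exact ⟨g, g.2, by rw [hinj h]; exact x.2⟩
  · rintro ⟨g, hg, h⟩
    exact ⟨⟨⟨_, h⟩, ⟨g, hg⟩⟩, by simp⟩

/-- The deformation `x ↦ t ^ a`, `y ↦ t ^ b * (1 + s * X)`, `z ↦ t ^ c * (1 + X)` of the
parametrization by `t`. -/
noncomputable def deform (K : Type*) {R : Type*} [CommRing K] [CommRing R] [Algebra K R] (t s : R)
    (a b c : ℕ) : MvPolynomial (Fin 3) K →ₐ[K] Polynomial R :=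
  aeval ![Polynomial.C (t ^ a), Polynomial.C (t ^ b) * (1 + Polynomial.C s * Polynomial.X),
    Polynomial.C (t ^ c) * (1 + Polynomial.X)]

section deform

variable {K R : Type*} [CommRing K] [CommRing R] [Algebra K R] {t s : R} {a b c : ℕ}

theorem coeff_zero_deform (f : MvPolynomial (Fin 3) K) :
    (deform K t s a b c f).coeff 0 = Polynomial.aeval t (toPoly K a b c f) := by
  have h : Polynomial.constantCoeff.comp (deform K t s a b c).toRingHom =
      ((Polynomial.aeval t).comp (toPoly K a b c)).toRingHom := by
    refine MvPolynomial.ringHom_ext (fun r => ?_) fun i => ?_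
    · simp [deform, toPoly, Polynomial.algebraMap_apply]
    · fin_cases i <;> simp [deform, toPoly, -map_pow] <;> rw [map_pow, Polynomial.aeval_X]
  exact congrArg (fun φ => φ f) h

theorem X_dvd_deform_iff (ht : Transcendental K t) {f : MvPolynomial (Fin 3) K} :
    Polynomial.X ∣ deform K t s a b c f ↔ f ∈ pIdeal K a b c := by
  rw [Polynomial.X_dvd_iff, coeff_zero_deform, pIdeal, RingHom.mem_ker,
    map_eq_zero_iff _ (transcendental_iff_injective.1 ht)]

theorem deform_monomial (m : Fin 3 →₀ ℕ) (r : K) :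
    deform K t s a b c (monomial m r) =
      Polynomial.C (algebraMap K R r * t ^ (a * m 0 + b * m 1 + c * m 2)) *
        ((1 + Polynomial.C s * Polynomial.X) ^ m 1 * (1 + Polynomial.X) ^ m 2) := by
  rw [deform, aeval_monomial, Finsupp.prod_fintype _ _ (by simp), Fin.prod_univ_three]
  simp only [Polynomial.algebraMap_apply, Matrix.cons_val_zero, Matrix.cons_val_one,
    Matrix.cons_val, map_mul, map_pow, mul_pow]
  ring

end deform

theorem X_pow_dvd_deform {K R : Type*} [CommRing K] [IsDomain K] [CommRing R] [IsDomain R]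
    [Algebra K R] {t s : R} (ht : Transcendental K t) {a b c n : ℕ} [(pIdeal K a b c).IsPrime]
    {f : MvPolynomial (Fin 3) K}
    (hf : f ∈ symbPow (pIdeal K a b c) n) : Polynomial.X ^ n ∣ deform K t s a b c f := by
  obtain ⟨g, hg, hfg⟩ := mem_symbPow_iff.1 hf
  have hle : pIdeal K a b c ^ n ≤
      (Ideal.span {(Polynomial.X : Polynomial R) ^ n}).comap (deform K t s a b c) := by
    rw [← Ideal.span_singleton_pow]
    refine le_trans (Ideal.pow_right_mono ?_ n) (Ideal.le_comap_pow _ n)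
    intro h hh
    exact Ideal.mem_span_singleton.2 ((X_dvd_deform_iff ht).2 hh)
  have hdvd : Polynomial.X ^ n ∣ deform K t s a b c f * deform K t s a b c g := by
    rw [← map_mul]
    exact Ideal.mem_span_singleton.1 (hle hfg)
  exact Polynomial.prime_X.pow_dvd_of_dvd_mul_right n
    (fun h => hg ((X_dvd_deform_iff ht).1 h)) hdvd

theorem coeff_deformFactor {P : Type*} [CommRing P] (j k i l : ℕ) :
    ((((1 + Polynomial.C Polynomial.X * Polynomial.X) ^ j * (1 + Polynomial.X) ^ k :
      Polynomial (Polynomial P)).coeff (i + l)).coeff i) =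
        (j.choose i : P) * k.choose l := by
  have h : ((1 + Polynomial.C Polynomial.X * Polynomial.X) ^ j :
      Polynomial (Polynomial P)) =
        ((1 + Polynomial.X) ^ j : Polynomial (Polynomial P)).comp
          (Polynomial.C Polynomial.X * Polynomial.X) := by simp
  have h1 : ∀ u, ((1 + Polynomial.C Polynomial.X * Polynomial.X) ^ j :
      Polynomial (Polynomial P)).coeff u =
      Polynomial.C (j.choose u : P) * Polynomial.X ^ u := by
    intro u
    rw [h, Polynomial.comp_C_mul_X_coeff, Polynomial.coeff_one_add_X_pow]
    simp
  rw [Polynomial.coeff_mul, Polynomial.finsetSum_coeff,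
    Finset.sum_eq_single (i, l)]
  · rw [h1, Polynomial.coeff_one_add_X_pow, mul_assoc, Polynomial.coeff_C_mul]
    have : (Polynomial.X ^ i * (k.choose l : Polynomial P)).coeff i =
        (k.choose l : P) := by
      rw [← Polynomial.C_eq_natCast, Polynomial.coeff_mul_C]
      simp
    rw [this]
  · rintro ⟨u, v⟩ huv hne
    rw [Finset.HasAntidiagonal.mem_antidiagonal] at huv
    simp only at huv
    have hu : i ≠ u := by
      rintro rfl
      exact hne (by rw [Prod.mk.injEq]; omega)
    rw [h1, Polynomial.coeff_one_add_X_pow, ← Polynomial.C_eq_natCast (k.choose v),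
      Polynomial.coeff_mul_C, Polynomial.coeff_C_mul, Polynomial.coeff_X_pow, if_neg hu]
    simp
  · simp

theorem sum_coeff_mul_choose_eq_zero {K : Type*} [CommRing K] [IsDomain K] {a b c n d : ℕ}
    [(pIdeal K a b c).IsPrime] {f : MvPolynomial (Fin 3) K}
    (hf : f ∈ gpiece K a b c (symbPow (pIdeal K a b c) n) d)
    {i j : ℕ} (hij : i + j < n) :
    ∑ m ∈ f.support, f.coeff m * ((m 1).choose i * (m 2).choose j) = 0 := by
  obtain ⟨hmem, hhom⟩ := hf
  have ht : Transcendental K (Polynomial.C Polynomial.X : Polynomial (Polynomial K)) :=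
    (transcendental_algebraMap_iff Polynomial.C_injective).2 (Polynomial.transcendental_X K)
  let φ := deform K (Polynomial.C Polynomial.X : Polynomial (Polynomial K)) Polynomial.X a b c
  obtain ⟨q, hq⟩ := X_pow_dvd_deform (s := Polynomial.X) ht hmem
  have h0 : ((φ f).coeff (i + j)).coeff i = 0 := by
    rw [hq, Polynomial.coeff_X_pow_mul', if_neg (by omega), Polynomial.coeff_zero]
  rw [f.as_sum, map_sum, Polynomial.finsetSum_coeff, Polynomial.finsetSum_coeff] at h0
  have hterm : ∀ m ∈ f.support, ((φ (monomial m (f.coeff m))).coeff (i + j)).coeff i =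
      Polynomial.X ^ d * Polynomial.C (f.coeff m * ((m 1).choose i * (m 2).choose j)) := by
    intro m hm
    have hw : a * m 0 + b * m 1 + c * m 2 = d := by
      rw [← (mem_weightedHomogeneousSubmodule _ _ _ _).1 hhom (mem_support_iff.1 hm),
        Finsupp.weight_apply, Finsupp.sum_fintype _ _ (by simp), Fin.sum_univ_three]
      simp [wt, mul_comm]
    rw [deform_monomial, hw, Polynomial.coeff_C_mul, Polynomial.algebraMap_apply,
      ← Polynomial.C_pow, ← Polynomial.C_mul, Polynomial.coeff_C_mul, coeff_deformFactor]
    simp only [map_mul, map_natCast, Algebra.algebraMap_self, Polynomial.algebraMap_apply,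
      RingHom.id_apply]
    ring
  rw [Finset.sum_congr rfl hterm, ← Finset.mul_sum, ← map_sum] at h0
  have := (mul_eq_zero.1 h0).resolve_left (pow_ne_zero _ Polynomial.X_ne_zero)
  exact Polynomial.C_eq_zero.1 this

/-- The monomial of degree `17407` with the exponents `p` of `y` and `z`. -/
noncomputable def exponentMonomial (p : ℕ × ℕ) : Fin 3 →₀ ℕ :=
  Finsupp.equivFunOnFinite.symm ![(17407 - (103 * p.1 + 169 * p.2)) / 5, p.1, p.2]

/-- over `𝔽₂`, `[𝔭_{𝔽₂}(5,103,169)^{(59)}]_{17407} = 0`. -/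
theorem statement18 :
    gpiece (ZMod 2) 5 103 169 (symbPow (pIdeal (ZMod 2) 5 103 169) 59) 17407 = ⊥ := by
  rw [Submodule.eq_bot_iff]
  intro f hf
  have hsupp : ∀ m ∈ f.support, (m 1, m 2) ∈ exponents ∧ exponentMonomial (m 1, m 2) = m := by
    intro m hm
    have hw : 5 * m 0 + 103 * m 1 + 169 * m 2 = 17407 := by
      rw [← (mem_weightedHomogeneousSubmodule _ _ _ _).1 hf.2 (mem_support_iff.1 hm),
        Finsupp.weight_apply, Finsupp.sum_fintype _ _ (by simp), Fin.sum_univ_three]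
      simp [wt, mul_comm]
    rw [mem_exponents, isExponent_iff]
    refine ⟨by simp only; omega, ?_⟩
    ext i
    fin_cases i
    · simp only [exponentMonomial, Finsupp.equivFunOnFinite_symm_apply_apply]
      change (17407 - (103 * m 1 + 169 * m 2)) / 5 = m 0
      omega
    · rfl
    · rfl
  have hsum : ∀ i j, i + j ≤ 58 →
      ∑ p ∈ exponents, f.coeff (exponentMonomial p) * (p.1.choose i * p.2.choose j) = 0 := by
    intro i j hij
    rw [← sum_coeff_mul_choose_eq_zero hf (i := i) (j := j) (by omega)]
    symm
    refine Finset.sum_of_injOn (fun m => (m 1, m 2)) ?_ ?_ ?_ ?_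
    · intro m hm m' hm' h
      rw [← (hsupp m hm).2, ← (hsupp m' hm').2]
      rw [show (m 1, m 2) = (m' 1, m' 2) from h]
    · intro m hm
      obtain ⟨h, -⟩ := hsupp m hm
      exact h
    · intro p _ hp
      have : f.coeff (exponentMonomial p) = 0 := by
        by_contra h
        exact hp ⟨exponentMonomial p, mem_support_iff.2 h, rfl⟩
      rw [this, zero_mul]
    · intro m hm
      simp only [(hsupp m hm).2]
  rw [← support_eq_empty, Finset.eq_empty_iff_forall_notMem]
  intro m hm
  obtain ⟨h1, h2⟩ := hsupp m hm
  have h := eq_zero_of_sum_choose_eq_zero _ hsum _ h1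
  rw [h2] at h
  exact mem_support_iff.1 hm h
end
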